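/- For every k ≥ 2 there exists a finite connected graph G with cop(G) = k and acop(G) = 2k; in particular the upper bound acop(G) ≤ 2·cop(G) is tight for every k ≥ 2. -/

import Mathlib

open SimpleGraph

universe u v

variable {V : Type u}

/-- A configuration in the game of Cops and Robbers with `n` cops:
the positions of the cops together with the position of the robber. -/
abbrev CRConfig (V : Type u) (n : ℕ) : Type u := (Fin n → V) × V

/-- A strategy for `n` cops in the *fully active* game on `G`:
initial positions, together with a move function (which may depend on the
full history of the play and on the current configuration) under which
every cop moves to an adjacent vertex on every turn. -/
structure ActiveCopStrategy (G : SimpleGraph V) (n : ℕ) where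
  init : Fin n → V
  move : List (CRConfig V n) → CRConfig V n → Fin n → V
  move_adj : ∀ h c i, G.Adj (c.1 i) (move h c i)

/-- A strategy for the robber in the *fully active* game on `G`:
an initial position (chosen knowing the cops' initial positions),
together with a move function (which may depend on the full history and on
the current configuration, whose first component records the cops' newly
chosen positions) under which the robber moves to an adjacent vertex on
every turn. -/
structure ActiveRobberStrategy (G : SimpleGraph V) (n : ℕ) where
  init : (Fin n → V) → V
  move : List (CRConfig V n) → CRConfig V n → V
  move_adj : ∀ h c, G.Adj c.2 (move h c)

/-- A strategy for `n` cops in the *passive* (classical) game on `G`: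
on her turn, each cop either moves to an adjacent vertex or stays put. -/
structure PassiveCopStrategy (G : SimpleGraph V) (n : ℕ) where
  init : Fin n → V
  move : List (CRConfig V n) → CRConfig V n → Fin n → V
  move_adj : ∀ h c i, G.Adj (c.1 i) (move h c i) ∨ move h c i = c.1 i

/-- A strategy for the robber in the *passive* (classical) game on `G`:
on his turn the robber either moves to an adjacent vertex or stays put. -/
structure PassiveRobberStrategy (G : SimpleGraph V) (n : ℕ) where
  init : (Fin n → V) → V
  move : List (CRConfig V n) → CRConfig V n → V
  move_adj : ∀ h c, G.Adj c.2 (move h c) ∨ move h c = c.2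

/-- The play determined by (the data of) a cop strategy and a robber strategy:
`crPlay n cinit rinit cmove rmove t` is the pair consisting of the history of
configurations strictly before round `t` and the configuration after round `t`
(a round consists of a cop move followed by a robber move; round `0` is the
initial placement, cops first, then the robber). -/
def crPlay (n : ℕ) (cinit : Fin n → V) (rinit : (Fin n → V) → V)
    (cmove : List (CRConfig V n) → CRConfig V n → Fin n → V)
    (rmove : List (CRConfig V n) → CRConfig V n → V) :
    ℕ → List (CRConfig V n) × CRConfig V n
  | 0 => ([], (cinit, rinit cinit))
  | t + 1 =>
      let p := crPlay n cinit rinit cmove rmove t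
      let c' := cmove p.1 p.2
      (p.1 ++ [p.2], (c', rmove p.1 (c', p.2.2)))

/-- The cops capture the robber in the given play: at some point of the play
(either right after a robber move, or right after a cop move) some cop
occupies the robber's vertex. -/
def crCaptures (n : ℕ) (cinit : Fin n → V) (rinit : (Fin n → V) → V)
    (cmove : List (CRConfig V n) → CRConfig V n → Fin n → V)
    (rmove : List (CRConfig V n) → CRConfig V n → V) : Prop :=
  ∃ t : ℕ,
    (∃ i, (crPlay n cinit rinit cmove rmove t).2.1 i
        = (crPlay n cinit rinit cmove rmove t).2.2) ∨
    (∃ i, cmove (crPlay n cinit rinit cmove rmove t).1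
            (crPlay n cinit rinit cmove rmove t).2 i
        = (crPlay n cinit rinit cmove rmove t).2.2)

/-- In the fully active game, the given cop strategy captures the robber
playing the given strategy. -/
def ActiveCapture {G : SimpleGraph V} {n : ℕ} (cs : ActiveCopStrategy G n)
    (rs : ActiveRobberStrategy G n) : Prop :=
  crCaptures n cs.init rs.init cs.move rs.move

/-- In the passive game, the given cop strategy captures the robber
playing the given strategy. -/
def PassiveCapture {G : SimpleGraph V} {n : ℕ} (cs : PassiveCopStrategy G n)
    (rs : PassiveRobberStrategy G n) : Prop :=
  crCaptures n cs.init rs.init cs.move rs.move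

/-- `n` cops have a winning strategy in the fully active game on `G`. -/
def ActiveCopsWin (G : SimpleGraph V) (n : ℕ) : Prop :=
  ∃ cs : ActiveCopStrategy G n, ∀ rs : ActiveRobberStrategy G n, ActiveCapture cs rs

/-- `n` cops have a winning strategy in the passive (classical) game on `G`. -/
def PassiveCopsWin (G : SimpleGraph V) (n : ℕ) : Prop :=
  ∃ cs : PassiveCopStrategy G n, ∀ rs : PassiveRobberStrategy G n, PassiveCapture cs rs

/-- The fully active cop number of `G`. -/
noncomputable def acop (G : SimpleGraph V) : ℕ := sInf {n | ActiveCopsWin G n}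

/-- The (classical, passive) cop number of `G`. -/
noncomputable def copNumber (G : SimpleGraph V) : ℕ := sInf {n | PassiveCopsWin G n}

section Generic

/-- Cops to move can force capture within `m` rounds. -/
def CWinN {n : ℕ} (M : V → V → Prop) : ℕ → (Fin n → V) → V → Prop
  | 0, c, r => ∃ i, c i = r
  | m + 1, c, r => (∃ i, c i = r) ∨ ∃ c' : Fin n → V, (∀ i, M (c i) (c' i)) ∧
      ∀ r', M r r' → (∃ i, c' i = r) ∨ CWinN M m c' r'

theorem CWinN.succ {n : ℕ} {M : V → V → Prop} :
    ∀ (m : ℕ) (c : Fin n → V) (r : V), CWinN M m c r → CWinN M (m + 1) c r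
  | 0, _, _, h => Or.inl h
  | m + 1, _, _, h => by
      rcases h with h | ⟨c', hc', h⟩
      · exact Or.inl h
      · exact Or.inr ⟨c', hc', fun r' hr' => (h r' hr').imp id (CWinN.succ m c' r')⟩

theorem CWinN.mono {n : ℕ} {M : V → V → Prop} {m m' : ℕ} (hm : m ≤ m')
    {c : Fin n → V} {r : V} (h : CWinN M m c r) : CWinN M m' c r := by
  induction hm with
  | refl => exact h
  | step _ ih => exact CWinN.succ _ _ _ ih

theorem crPlay_length (n : ℕ) (cinit : Fin n → V) (rinit : (Fin n → V) → V)
    (cmove : List (CRConfig V n) → CRConfig V n → Fin n → V)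
    (rmove : List (CRConfig V n) → CRConfig V n → V) (t : ℕ) :
    (crPlay n cinit rinit cmove rmove t).1.length = t := by
  induction t with
  | zero => simp [crPlay]
  | succ t ih => simp [crPlay, ih]

open Classical in
theorem cwin_extract {n : ℕ} (M : V → V → Prop) (hM : ∀ v, ∃ w, M v w) (N : ℕ)
    (c0 : Fin n → V) (h0 : ∀ r, CWinN M N c0 r) :
    ∃ cmove : List (CRConfig V n) → CRConfig V n → Fin n → V,
      (∀ h c i, M (c.1 i) (cmove h c i)) ∧
      ∀ rinit rmove, (∀ h c, M c.2 (rmove h c)) → crCaptures n c0 rinit cmove rmove := by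
  choose d hd using hM
  let Good (h : List (CRConfig V n)) (c : CRConfig V n) (c' : Fin n → V) : Prop :=
    (∀ i, M (c.1 i) (c' i)) ∧
      ∀ r', M c.2 r' → (∃ i, c' i = c.2) ∨ CWinN M (N - h.length - 1) c' r'
  let mv : List (CRConfig V n) → CRConfig V n → Fin n → V := fun h c =>
    if hh : ∃ c', Good h c c' then hh.choose else fun i => d (c.1 i)
  have hmv : ∀ h c, (∃ c', Good h c c') → Good h c (mv h c) := by
    intro h c hh
    simp only [mv, dif_pos hh]
    exact hh.choose_spec
  refine ⟨mv, ?_, ?_⟩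
  · intro h c i
    by_cases hh : ∃ c', Good h c c'
    · exact (hmv h c hh).1 i
    · simp only [mv, dif_neg hh]
      exact hd _
  · intro rinit rmove hr
    by_contra hcap
    simp only [crCaptures, not_exists, not_or] at hcap
    have key : ∀ t, t ≤ N → CWinN M (N - t) (crPlay n c0 rinit mv rmove t).2.1
        (crPlay n c0 rinit mv rmove t).2.2 := by
      intro t
      induction t with
      | zero => intro _; exact h0 _
      | succ t ih =>
        intro ht
        have h1 := ih (by omega)
        obtain ⟨q, hq⟩ : ∃ q, N - t = q + 1 := ⟨N - t - 1, by omega⟩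
        rw [hq] at h1
        have hN : N - (t + 1) = q := by omega
        rw [hN]
        rcases h1 with ⟨i, hi⟩ | ⟨c', hc', h1⟩
        · exact absurd hi ((hcap t).1 i)
        · have hlen := crPlay_length n c0 rinit mv rmove t
          have hg := hmv (crPlay n c0 rinit mv rmove t).1 (crPlay n c0 rinit mv rmove t).2
            ⟨c', hc', by
              have : N - (crPlay n c0 rinit mv rmove t).1.length - 1 = q := by omega
              rw [this]; exact h1⟩
          have h2 := hg.2 (rmove (crPlay n c0 rinit mv rmove t).1
            (mv (crPlay n c0 rinit mv rmove t).1 (crPlay n c0 rinit mv rmove t).2,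
              (crPlay n c0 rinit mv rmove t).2.2)) (hr (crPlay n c0 rinit mv rmove t).1
              (mv (crPlay n c0 rinit mv rmove t).1 (crPlay n c0 rinit mv rmove t).2,
              (crPlay n c0 rinit mv rmove t).2.2))
          have : N - (crPlay n c0 rinit mv rmove t).1.length - 1 = q := by omega
          rw [this] at h2
          rcases h2 with ⟨i, hi⟩ | h2
          · exact absurd hi ((hcap t).2 i)
          · exact h2
    have := key N le_rfl
    rw [Nat.sub_self] at this
    obtain ⟨i, hi⟩ := this
    exact (hcap N).1 i hi

open Classical in
theorem robber_extract {n : ℕ} (M : V → V → Prop) (hM : ∀ v, ∃ w, M v w)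
    (S : (Fin n → V) → V → Prop) (h0 : ∀ c, ∃ r, S c r)
    (hne : ∀ c r, S c r → ∀ i, c i ≠ r)
    (hne' : ∀ c r, S c r → ∀ c' : Fin n → V, (∀ i, M (c i) (c' i)) → ∀ i, c' i ≠ r)
    (hS : ∀ c r, S c r → ∀ c' : Fin n → V, (∀ i, M (c i) (c' i)) → ∃ r', M r r' ∧ S c' r') :
    ∃ (rinit : (Fin n → V) → V) (rmove : List (CRConfig V n) → CRConfig V n → V),
      (∀ h c, M c.2 (rmove h c)) ∧
      ∀ cinit cmove, (∀ h c i, M (c.1 i) (cmove h c i)) →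
        ¬ crCaptures n cinit rinit cmove rmove := by
  choose d hd using hM
  choose ri hri using h0
  let mv : List (CRConfig V n) → CRConfig V n → V := fun _ c =>
    if hh : ∃ r', M c.2 r' ∧ S c.1 r' then hh.choose else d c.2
  have hmv : ∀ h c, (∃ r', M c.2 r' ∧ S c.1 r') → M c.2 (mv h c) ∧ S c.1 (mv h c) := by
    intro h c hh
    simp only [mv, dif_pos hh]
    exact hh.choose_spec
  refine ⟨ri, mv, ?_, ?_⟩
  · intro h c
    by_cases hh : ∃ r', M c.2 r' ∧ S c.1 r'
    · exact (hmv h c hh).1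
    · simp only [mv, dif_neg hh]
      exact hd _
  · intro cinit cmove hc
    have key : ∀ t, S (crPlay n cinit ri cmove mv t).2.1 (crPlay n cinit ri cmove mv t).2.2 := by
      intro t
      induction t with
      | zero => exact hri _
      | succ t ih =>
        have h1 := hS _ _ ih _ (hc (crPlay n cinit ri cmove mv t).1 (crPlay n cinit ri cmove mv t).2)
        exact (hmv (crPlay n cinit ri cmove mv t).1
          (cmove (crPlay n cinit ri cmove mv t).1 (crPlay n cinit ri cmove mv t).2,
            (crPlay n cinit ri cmove mv t).2.2) h1).2
    rintro ⟨t, ⟨i, hi⟩ | ⟨i, hi⟩⟩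
    · exact hne _ _ (key t) i hi
    · exact hne' _ _ (key t) _ (hc _ _) i hi

theorem passive_lose {G : SimpleGraph V} {n : ℕ} (M : V → V → Prop)
    (hMG : M = (fun a b => G.Adj a b ∨ b = a)) (hM : ∀ v, ∃ w, M v w)
    (S : (Fin n → V) → V → Prop) (h0 : ∀ c, ∃ r, S c r)
    (hne : ∀ c r, S c r → ∀ i, c i ≠ r)
    (hne' : ∀ c r, S c r → ∀ c' : Fin n → V, (∀ i, M (c i) (c' i)) → ∀ i, c' i ≠ r)
    (hS : ∀ c r, S c r → ∀ c' : Fin n → V, (∀ i, M (c i) (c' i)) → ∃ r', M r r' ∧ S c' r') :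
    ¬ PassiveCopsWin G n := by
  subst hMG
  rintro ⟨cs, hcs⟩
  obtain ⟨ri, rm, h1, h2⟩ := robber_extract _ hM S h0 hne hne' hS
  exact h2 cs.init cs.move cs.move_adj (hcs ⟨ri, rm, h1⟩)

theorem passive_win {G : SimpleGraph V} {n : ℕ} (N : ℕ) (c0 : Fin n → V)
    (h0 : ∀ r, CWinN (fun a b => G.Adj a b ∨ b = a) N c0 r) : PassiveCopsWin G n := by
  obtain ⟨mv, h1, h2⟩ := cwin_extract (fun a b => G.Adj a b ∨ b = a)
    (fun v => ⟨v, Or.inr rfl⟩) N c0 h0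
  exact ⟨⟨c0, mv, h1⟩, fun rs => h2 _ _ rs.move_adj⟩

theorem active_lose {G : SimpleGraph V} {n : ℕ} (M : V → V → Prop)
    (hMG : M = G.Adj) (hM : ∀ v, ∃ w, M v w)
    (S : (Fin n → V) → V → Prop) (h0 : ∀ c, ∃ r, S c r)
    (hne : ∀ c r, S c r → ∀ i, c i ≠ r)
    (hne' : ∀ c r, S c r → ∀ c' : Fin n → V, (∀ i, M (c i) (c' i)) → ∀ i, c' i ≠ r)
    (hS : ∀ c r, S c r → ∀ c' : Fin n → V, (∀ i, M (c i) (c' i)) → ∃ r', M r r' ∧ S c' r') :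
    ¬ ActiveCopsWin G n := by
  subst hMG
  rintro ⟨cs, hcs⟩
  obtain ⟨ri, rm, h1, h2⟩ := robber_extract _ hM S h0 hne hne' hS
  exact h2 cs.init cs.move cs.move_adj (hcs ⟨ri, rm, h1⟩)

theorem active_win {G : SimpleGraph V} {n : ℕ} (hG : ∀ v, ∃ w, G.Adj v w) (N : ℕ)
    (c0 : Fin n → V) (h0 : ∀ r, CWinN G.Adj N c0 r) : ActiveCopsWin G n := by
  obtain ⟨mv, h1, h2⟩ := cwin_extract _ hG N c0 h0
  exact ⟨⟨c0, mv, h1⟩, fun rs => h2 _ _ rs.move_adj⟩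

open Classical in
theorem active_sim {G : SimpleGraph V} {k n : ℕ} (E : Bool × Fin k ≃ Fin n) (m : ℕ) :
    ∀ (c : Fin k → V) (d : Fin n → V) (r : V),
    (∀ i, ∃ b, d (E (b, i)) = c i ∧ G.Adj (c i) (d (E (!b, i)))) →
    CWinN (fun a b => G.Adj a b ∨ b = a) m c r → CWinN G.Adj m d r := by
  induction m with
  | zero =>
    rintro c d r hd ⟨i, hi⟩
    obtain ⟨b, hb, _⟩ := hd i
    exact ⟨_, hb.trans hi⟩
  | succ m ih =>
    intro c d r hd h
    rcases h with ⟨i, hi⟩ | ⟨c', hc', h⟩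
    · obtain ⟨b, hb, _⟩ := hd i
      exact Or.inl ⟨_, hb.trans hi⟩
    · choose β hβ hadj using hd
      let D : Bool × Fin k → V := fun q =>
        if c' q.2 = c q.2 then d (E (!q.1, q.2)) else if q.1 = β q.2 then c' q.2 else c q.2
      have hinv : ∀ i, ∃ b, D (b, i) = c' i ∧ G.Adj (c' i) (D (!b, i)) := by
        intro i
        by_cases hi : c' i = c i
        · refine ⟨!(β i), ?_, ?_⟩
          · simp [D, hi, hβ]
          · simp [D, hi, hadj]
        · refine ⟨β i, ?_, ?_⟩
          · simp [D, hi]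
          · simp [D, hi]
            exact ((hc' i).resolve_right hi).symm
      refine Or.inr ⟨fun j => D (E.symm j), ?_, ?_⟩
      · intro j
        obtain ⟨⟨b, i⟩, rfl⟩ := E.surjective j
        simp only [Equiv.symm_apply_apply]
        have h1 := hβ i
        have h2 := hadj i
        by_cases hi : c' i = c i
        · simp only [D, hi, if_true]
          by_cases hb : b = β i
          · subst hb; rw [h1]; exact h2
          · have : (!b) = β i := by cases b <;> cases hh : β i <;> simp_all
            rw [this, h1]
            have : b = !(β i) := by cases b <;> cases hh : β i <;> simp_all
            rw [this]; exact h2.symm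
        · have h3 := (hc' i).resolve_right hi
          by_cases hb : b = β i
          · subst hb; simp only [D, hi, if_true, if_false]; rw [h1]; exact h3
          · simp only [D, hi, if_false, hb]
            have : b = !(β i) := by cases b <;> cases hh : β i <;> simp_all
            rw [this]; exact h2.symm
      · intro r' hr'
        rcases h r' (Or.inl hr') with ⟨i, hi⟩ | h
        · obtain ⟨b, hb, _⟩ := hinv i
          exact Or.inl ⟨E (b, i), by simp only [Equiv.symm_apply_apply]; exact hb.trans hi⟩
        · exact Or.inr (ih c' _ r' (by simpa only [Equiv.symm_apply_apply] using hinv) h)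

end Generic

section Construction

variable {F : Type} [Field F] {k t : ℕ}

/-- Base vertices: points of the plane and lines of `k` given slopes. -/
abbrev CRBase (F : Type) (k : ℕ) : Type := (F × F) ⊕ (Fin k × F)

/-- Incidence. -/
def crInc (s : Fin k → F) (P : F × F) (L : Fin k × F) : Prop := P.2 = s L.1 * P.1 + L.2

/-- Adjacency in the incidence graph. -/
def crBAdj (s : Fin k → F) : CRBase F k → CRBase F k → Prop
  | .inl P, .inr L => crInc s P L
  | .inr L, .inl P => crInc s P L
  | _, _ => False

theorem crBAdj_symm (s : Fin k → F) : ∀ x y, crBAdj s x y → crBAdj s y x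
  | .inl _, .inr _, h => h
  | .inr _, .inl _, h => h

/-- The blow-up of the incidence graph. -/
def crG (s : Fin k → F) (t : ℕ) : SimpleGraph (CRBase F k × Fin t) where
  Adj x y := crBAdj s x.1 y.1
  symm := ⟨fun x y h => crBAdj_symm s x.1 y.1 h⟩
  loopless := ⟨by rintro ⟨x | x, _⟩ h <;> exact h⟩

/-- The line of class `j` through `P`. -/
def crLine (s : Fin k → F) (P : F × F) (j : Fin k) : Fin k × F := (j, P.2 - s j * P.1)

theorem crLine_inc (s : Fin k → F) (P : F × F) (j : Fin k) : crInc s P (crLine s P j) := by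
  simp [crInc, crLine]

theorem crInc_eq {s : Fin k → F} {P : F × F} {L : Fin k × F} (h : crInc s P L) :
    L = crLine s P L.1 := by
  ext
  · rfl
  · simp only [crInc, crLine] at *
    rw [h]; ring

/-- `k` neighbours of a base vertex. -/
def crNb (s : Fin k → F) : CRBase F k → Fin k → CRBase F k
  | .inl P, j => .inr (crLine s P j)
  | .inr L, j => .inl (s j, s L.1 * s j + L.2)

theorem crNb_adj (s : Fin k → F) (v : CRBase F k) (j : Fin k) : crBAdj s v (crNb s v j) := by
  rcases v with P | L
  · exact crLine_inc s P j
  · simp [crBAdj, crNb, crInc]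

theorem crMeet {s : Fin k → F} (hs : Function.Injective s) {L M : Fin k × F} (h : L.1 ≠ M.1) :
    ∃ P, crInc s P L ∧ crInc s P M := by
  have h1 : s L.1 - s M.1 ≠ 0 := sub_ne_zero.mpr (fun e => h (hs e))
  refine ⟨((M.2 - L.2) / (s L.1 - s M.1), s L.1 * ((M.2 - L.2) / (s L.1 - s M.1)) + L.2), rfl, ?_⟩
  simp only [crInc]
  field_simp
  ring

theorem crNb_unique {s : Fin k → F} (hs : Function.Injective s) {v x : CRBase F k} (hx : x ≠ v)
    {j j' : Fin k} (h : crNb s v j = x ∨ crBAdj s x (crNb s v j))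
    (h' : crNb s v j' = x ∨ crBAdj s x (crNb s v j')) : j = j' := by
  rcases v with P | L <;> rcases x with Q | M
  · simp only [crNb, crBAdj, crInc, crLine, reduceCtorEq, false_or] at h h'
    by_contra hj
    have h1 : s j - s j' ≠ 0 := sub_ne_zero.mpr (fun e => hj (hs e))
    have h2 : (s j - s j') * (Q.1 - P.1) = 0 := by linear_combination h' - h
    have h3 : Q.1 = P.1 := sub_eq_zero.mp ((mul_eq_zero.mp h2).resolve_left h1)
    apply hx
    congr 1
    ext
    · exact h3
    · rw [h, h3]; ring
  · simp only [crNb, crBAdj, crLine, or_false, Sum.inr.injEq] at h h'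
    rw [← h'] at h
    exact congrArg Prod.fst h
  · simp only [crNb, crBAdj, or_false, Sum.inl.injEq] at h h'
    rw [← h'] at h
    exact hs (congrArg Prod.fst h)
  · simp only [crNb, crBAdj, crInc, reduceCtorEq, false_or] at h h'
    by_contra hj
    have h1 : s j - s j' ≠ 0 := sub_ne_zero.mpr (fun e => hj (hs e))
    have h2 : (s j - s j') * (s L.1 - s M.1) = 0 := by linear_combination h - h'
    have h3 : s L.1 = s M.1 := sub_eq_zero.mp ((mul_eq_zero.mp h2).resolve_left h1)
    apply hx
    congr 1
    ext1
    · exact (hs h3).symm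
    · rw [h3] at h
      exact (add_left_cancel h).symm

theorem crEscape {s : Fin k → F} (hs : Function.Injective s) {ι : Type} (I : Finset ι)
    (hI : I.card < k) (x : ι → CRBase F k) (v : CRBase F k) (hx : ∀ i ∈ I, x i ≠ v) :
    ∃ w, crBAdj s v w ∧ ∀ i ∈ I, w ≠ x i ∧ ¬ crBAdj s (x i) w := by
  classical
  by_contra hcon
  push Not at hcon
  have hbad : ∀ j : Fin k, ∃ i ∈ I, crNb s v j = x i ∨ crBAdj s (x i) (crNb s v j) := by
    intro j
    obtain ⟨i, hi, h⟩ := hcon _ (crNb_adj s v j)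
    exact ⟨i, hi, or_iff_not_imp_left.mpr h⟩
  choose f hf hf' using hbad
  have hinj : Function.Injective f := by
    intro j j' e
    have h' := hf' j'
    rw [← e] at h'
    exact crNb_unique hs (hx _ (hf j)) (hf' j) h'
  have : (Finset.univ : Finset (Fin k)).card ≤ I.card :=
    Finset.card_le_card_of_injOn f (fun j _ => hf j) hinj.injOn
  simp at this
  omega

/-! ### Passive lower bound -/

theorem crPassive_lower {s : Fin k → F} (hs : Function.Injective s) (ht : 0 < t) {n : ℕ}
    (hn : n < k) : ¬ PassiveCopsWin (crG s t) n := by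
  have hcard : (Finset.univ : Finset (Fin n)).card < k := by simpa using hn
  refine passive_lose
    (fun a b => (crG s t).Adj a b ∨ b = a) rfl (fun v => ⟨v, Or.inr rfl⟩)
    (fun c r => ∀ i, r.1 ≠ (c i).1 ∧ ¬ crBAdj s (c i).1 r.1) ?_ ?_ ?_ ?_
  · intro c
    have : ∃ j : Fin k, ∀ i, (c i).1 ≠ Sum.inr (j, 0) := by
      by_contra hcon
      push Not at hcon
      choose f hf using hcon
      have hinj : Function.Injective f := by
        intro j j' e
        have := hf j
        rw [e, hf j'] at this
        simpa using this.symm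
      have := Fintype.card_le_of_injective f hinj
      simp at this
      omega
    obtain ⟨j, hj⟩ := this
    obtain ⟨w, _, hw⟩ := crEscape hs Finset.univ hcard (fun i => (c i).1) (Sum.inr (j, 0))
      (fun i _ => hj i)
    exact ⟨(w, ⟨0, ht⟩), fun i => hw i (Finset.mem_univ i)⟩
  · intro c r h i e
    exact (h i).1 (by rw [e])
  · intro c r h c' hc' i e
    rcases hc' i with h3 | h3
    · rw [e] at h3; exact (h i).2 h3
    · rw [e] at h3; exact (h i).1 (by rw [h3])
  · intro c r h c' hc'
    obtain ⟨w, hw1, hw⟩ := crEscape hs Finset.univ hcard (fun i => (c' i).1) r.1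
      (fun i _ e => by
        rcases hc' i with h3 | h3
        · have h3 : crBAdj s (c i).1 (c' i).1 := h3
          rw [e] at h3; exact (h i).2 h3
        · rw [h3] at e; exact (h i).1 e.symm)
    exact ⟨(w, ⟨0, ht⟩), Or.inl hw1, fun i => hw i (Finset.mem_univ i)⟩

/-! ### Active lower bound -/

theorem crSide {s : Fin k → F} {x y : CRBase F k} (h : crBAdj s x y) :
    y.isLeft = !x.isLeft := by
  rcases x with x | x <;> rcases y with y | y <;> simp_all [crBAdj]

theorem crFresh {n : ℕ} (c : Fin n → CRBase F k × Fin t) (hn : n < t) (w : CRBase F k) :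
    ∃ a : Fin t, ∀ i, c i ≠ (w, a) := by
  by_contra hcon
  push Not at hcon
  choose f hf using hcon
  have hinj : Function.Injective f := by
    intro j j' e
    have := hf j
    rw [e, hf j'] at this
    simpa using this.symm
  have := Fintype.card_le_of_injective f hinj
  simp at this
  omega

theorem crActive_lower {s : Fin k → F} (hs : Function.Injective s) {n : ℕ}
    (hn : n < 2 * k) (hnt : n < t) : ¬ ActiveCopsWin (crG s t) n := by
  classical
  have hk : 0 < k := by omega
  have ht : 0 < t := by omega
  let D (c : Fin n → CRBase F k × Fin t) (b : Bool) : Finset (Fin n) :=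
    Finset.univ.filter fun i => (c i).1.isLeft = b
  have hmem : ∀ c b i, i ∈ D c b ↔ (c i).1.isLeft = b := by simp [D]
  have hD : ∀ c, ∃ b, (D c b).card < k := by
    intro c
    by_contra hcon
    push Not at hcon
    have h1 := hcon true
    have h2 := hcon false
    have hdis : Disjoint (D c true) (D c false) := by
      rw [Finset.disjoint_left]; intro i; simp [hmem]
    have h3 := Finset.card_union_of_disjoint hdis
    have h4 := Finset.card_le_univ (D c true ∪ D c false)
    simp at h4
    omega
  refine active_lose
    (crG s t).Adj rfl (fun v => ⟨(crNb s v.1 ⟨0, hk⟩, v.2), crNb_adj s v.1 _⟩)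
    (fun c r => (D c (!r.1.isLeft)).card < k ∧ (∀ i, c i ≠ r) ∧
      ∀ i, ¬ crBAdj s (c i).1 r.1) ?_ ?_ ?_ ?_
  · intro c
    obtain ⟨b, hb⟩ := hD c
    have : ∃ v : CRBase F k, v.isLeft = b ∧ ∀ i ∈ D c b, (c i).1 ≠ v := by
      by_contra hcon
      push Not at hcon
      let g : Fin k → CRBase F k := fun j => if b then .inl (s j, 0) else .inr (j, 0)
      have hg : ∀ j, (g j).isLeft = b := by intro j; cases b <;> rfl
      have hgi : Function.Injective g := by
        intro j j' e
        cases b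
        · simpa [g] using e
        · exact hs (by simpa [g] using e)
      choose f hf hf' using fun j => hcon (g j) (hg j)
      have hinj : Function.Injective f := by
        intro j j' e
        have := hf' j
        rw [e, hf' j'] at this
        exact (hgi this).symm
      have : (Finset.univ : Finset (Fin k)).card ≤ (D c b).card :=
        Finset.card_le_card_of_injOn f (fun j _ => hf j) hinj.injOn
      simp at this
      omega
    obtain ⟨v, hvb, hv⟩ := this
    obtain ⟨w, hvw, hw⟩ := crEscape hs (D c b) hb (fun i => (c i).1) v hv
    obtain ⟨a, ha⟩ := crFresh c hnt w
    have hwb : (!w.isLeft) = b := by rw [crSide hvw, hvb]; simp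
    refine ⟨(w, a), by simpa [hwb] using hb, ha, fun i hi => ?_⟩
    refine (hw i ?_).2 hi
    rw [hmem, ← hwb, crSide hi]; simp
  · intro c r h i
    exact h.2.1 i
  · intro c r h c' hc' i e
    have h3 := hc' i
    rw [e] at h3
    exact h.2.2 i h3
  · intro c r h c' hc'
    have hsub : D c' r.1.isLeft ⊆ D c (!r.1.isLeft) := by
      intro i hi
      rw [hmem] at *
      rw [← hi, crSide (hc' i)]; simp
    have hcard := (Finset.card_le_card hsub).trans_lt h.1
    obtain ⟨w, hvw, hw⟩ := crEscape hs (D c' r.1.isLeft) hcard (fun i => (c' i).1) r.1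
      (fun i _ e => by
        have h3 : crBAdj s (c i).1 (c' i).1 := hc' i
        rw [e] at h3; exact h.2.2 i h3)
    obtain ⟨a, ha⟩ := crFresh c' hnt w
    have hwb : (!w.isLeft) = r.1.isLeft := by rw [crSide hvw]; simp
    refine ⟨(w, a), hvw, by simpa [hwb] using hcard, ha, fun i hi => ?_⟩
    refine (hw i ?_).2 hi
    rw [hmem, ← hwb, crSide hi]; simp

/-! ### Passive upper bound -/

/-- Passive move relation. -/
def crM (s : Fin k → F) (t : ℕ) (a b : CRBase F k × Fin t) : Prop :=
  (crG s t).Adj a b ∨ b = a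

theorem crCapture {s : Fin k → F} {n : ℕ} {c : Fin n → CRBase F k × Fin t}
    {r : CRBase F k × Fin t} (i : Fin n) (h : crBAdj s (c i).1 r.1) (m : ℕ) :
    CWinN (crM s t) (m + 1) c r := by
  classical
  refine Or.inr ⟨Function.update c i r, fun j => ?_, fun r' _ => Or.inl ⟨i, by simp⟩⟩
  by_cases hj : j = i
  · subst hj; simp only [Function.update_self]; exact Or.inl h
  · rw [Function.update_of_ne hj]; exact Or.inr rfl

theorem crFrozen {s : Fin k → F} {n : ℕ} {c : Fin n → CRBase F k × Fin t}
    {r : CRBase F k × Fin t} (i j : Fin n) (hij : i ≠ j) (hi : (c i).1 = r.1)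
    (x : CRBase F k × Fin t) (hx : crBAdj s (c j).1 x.1) (m : ℕ)
    (h : CWinN (crM s t) (m + 1) (Function.update c j x) r) :
    CWinN (crM s t) (m + 2) c r := by
  refine Or.inr ⟨Function.update c j x, fun l => ?_, fun r' hr' => Or.inr ?_⟩
  · by_cases hl : l = j
    · subst hl; simp only [Function.update_self]; exact Or.inl hx
    · rw [Function.update_of_ne hl]; exact Or.inr rfl
  · rcases hr' with hr' | rfl
    · refine crCapture i ?_ m
      rw [Function.update_of_ne hij, hi]
      exact hr'
    · exact h

theorem crS1 {s : Fin k → F} (hk : 2 ≤ k) {c : Fin k → CRBase F k × Fin t}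
    (P : F × F) (a : Fin t) (Q : Fin k → F × F) (hQ : ∀ j, (c j).1 = Sum.inl (Q j))
    (hP : ∀ j, crInc s (Q j) (crLine s P j)) :
    CWinN (crM s t) 4 c (Sum.inl P, a) := by
  let i0 : Fin k := ⟨0, by omega⟩
  let i1 : Fin k := ⟨1, by omega⟩
  have h01 : i0 ≠ i1 := by simp [i0, i1]
  refine Or.inr ⟨Function.update c i0 (Sum.inr (crLine s P i0), a), fun l => ?_,
    fun r' hr' => Or.inr ?_⟩
  · by_cases hl : l = i0
    · subst hl; simp only [Function.update_self]; left
      change crBAdj s _ _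
      rw [hQ]; exact hP _
    · rw [Function.update_of_ne hl]; exact Or.inr rfl
  · rcases hr' with hr' | rfl
    · obtain ⟨x | L, b⟩ := r'
      · exact hr'.elim
      · have hL : L = crLine s P L.1 := crInc_eq hr'
        by_cases hj : L.1 = i0
        · rw [hj] at hL
          subst hL
          refine crFrozen i0 i1 h01 (by simp) (Sum.inr (crLine s P i1), a) ?_ 1 ?_
          · rw [Function.update_of_ne h01.symm, hQ]; exact hP _
          refine crFrozen i0 i1 h01 (by simp [Function.update_of_ne h01]) (Sum.inl P, a) ?_ 0 ?_
          · simp only [Function.update_self]; exact crLine_inc s P i1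
          refine crCapture i1 ?_ 0
          simp only [Function.update_self]; exact crLine_inc s P i0
        · refine crCapture L.1 ?_ 2
          rw [Function.update_of_ne hj, hQ]
          have := hP L.1
          rw [← hL] at this
          exact this
    · refine crCapture i0 ?_ 2
      simp only [Function.update_self]; exact crLine_inc s P i0

theorem crS0P {s : Fin k → F} (hk : 2 ≤ k) {c : Fin k → CRBase F k × Fin t}
    (P : F × F) (a : Fin t) (Q : Fin k → CRBase F k × Fin t)
    (hQ : ∀ j, crM s t (c j) (Q j)) (hQ' : ∀ j, ∃ R, (Q j).1 = Sum.inl R ∧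
      crInc s R (crLine s P j)) :
    CWinN (crM s t) 5 c (Sum.inl P, a) := by
  choose R hR hR' using hQ'
  refine Or.inr ⟨Q, hQ, fun r' hr' => Or.inr ?_⟩
  rcases hr' with hr' | rfl
  · obtain ⟨x | L, b⟩ := r'
    · exact hr'.elim
    · have hL : L = crLine s P L.1 := crInc_eq hr'
      refine crCapture L.1 ?_ 3
      rw [hR]
      have := hR' L.1
      rw [← hL] at this
      exact this
  · exact crS1 hk P a R hR hR'

theorem crPassive_upper {s : Fin k → F} (hs : Function.Injective s) (hk : 2 ≤ k) (ht : 0 < t) :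
    ∃ c : Fin k → CRBase F k × Fin t, ∀ r, CWinN (crM s t) 6 c r := by
  have : ∀ j : Fin k, ∃ j' : Fin k, j' ≠ j := by
    intro j
    have : Nontrivial (Fin k) := Fin.nontrivial_iff_two_le.mpr hk
    exact exists_ne j
  choose σ hσ using this
  refine ⟨fun j => (Sum.inr (σ j, 0), ⟨0, ht⟩), ?_⟩
  rintro ⟨P | L, a⟩
  · refine CWinN.succ _ _ _ ?_
    have : ∀ j, ∃ R, crInc s R (σ j, 0) ∧ crInc s R (crLine s P j) :=
      fun j => crMeet hs (hσ j)
    choose R hR hR' using this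
    exact crS0P hk P a (fun j => (Sum.inl (R j), a)) (fun j => Or.inl (hR j))
      (fun j => ⟨R j, rfl, hR' j⟩)
  · obtain ⟨Q, hQ, hQ'⟩ := crMeet (L := (σ L.1, 0)) (M := L) hs (hσ L.1)
    refine Or.inr ⟨Function.update (fun j => (Sum.inr (σ j, 0), ⟨0, ht⟩)) L.1 (Sum.inl Q, a), fun l => ?_, fun r' hr' => Or.inr ?_⟩
    · by_cases hl : l = L.1
      · subst hl; simp only [Function.update_self]; exact Or.inl hQ
      · rw [Function.update_of_ne hl]; exact Or.inr rfl
    · rcases hr' with hr' | rfl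
      · obtain ⟨P | M, b⟩ := r'
        · have : ∀ j, ∃ R, crInc s R (σ j, 0) ∧ crInc s R (crLine s P j) :=
            fun j => crMeet hs (hσ j)
          choose R hR hR' using this
          have hL : L = crLine s P L.1 := crInc_eq hr'
          refine crS0P hk P b (fun j => if j = L.1 then (Sum.inl Q, a) else (Sum.inl (R j), a))
            (fun j => ?_) (fun j => ?_)
          · by_cases hj : j = L.1
            · simp only [if_pos hj]; subst hj
              simp only [Function.update_self]; exact Or.inr rfl
            · simp only [if_neg hj]
              rw [Function.update_of_ne hj]; exact Or.inl (hR j)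
          · by_cases hj : j = L.1
            · simp only [if_pos hj]
              exact ⟨Q, rfl, by rw [hj, ← hL]; exact hQ'⟩
            · simp only [if_neg hj]
              exact ⟨R j, rfl, hR' j⟩
        · exact hr'.elim
      · refine crCapture L.1 ?_ 4
        simp only [Function.update_self]; exact hQ'

theorem crConnected {s : Fin k → F} (hs : Function.Injective s) (hk : 2 ≤ k) (ht : 0 < t) :
    (crG s t).Connected := by
  let i0 : Fin k := ⟨0, by omega⟩
  let i1 : Fin k := ⟨1, by omega⟩
  have h01 : i0 ≠ i1 := by simp [i0, i1]
  have hpp : ∀ P P' a a', (crG s t).Reachable (Sum.inl P, a) (Sum.inl P', a') := by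
    intro P P' a a'
    obtain ⟨Q, h1, h2⟩ := crMeet (L := crLine s P i0) (M := crLine s P' i1) hs h01
    have e1 : (crG s t).Adj (Sum.inl P, a) (Sum.inr (crLine s P i0), a) := crLine_inc s P i0
    have e2 : (crG s t).Adj (Sum.inr (crLine s P i0), a) (Sum.inl Q, a) := h1
    have e3 : (crG s t).Adj (Sum.inl Q, a) (Sum.inr (crLine s P' i1), a) := h2
    have e4 : (crG s t).Adj (Sum.inr (crLine s P' i1), a) (Sum.inl P', a') := crLine_inc s P' i1
    exact e1.reachable.trans (e2.reachable.trans (e3.reachable.trans e4.reachable))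
  have hx : ∀ x : CRBase F k × Fin t, ∃ P a, (crG s t).Reachable x (Sum.inl P, a) := by
    rintro ⟨P | L, a⟩
    · exact ⟨P, a, SimpleGraph.Reachable.refl _⟩
    · have e : (crG s t).Adj (Sum.inr L, a) (crNb s (Sum.inr L) i0, a) :=
        crNb_adj s (Sum.inr L) i0
      exact ⟨_, a, e.reachable⟩
  have : Nonempty (CRBase F k × Fin t) := ⟨(Sum.inl (0, 0), ⟨0, ht⟩)⟩
  refine ⟨fun x y => ?_⟩
  obtain ⟨P, a, h1⟩ := hx x
  obtain ⟨P', a', h2⟩ := hx y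
  exact h1.trans ((hpp P P' a a').trans h2.symm)

end Construction

/-- For every `k ≥ 2` there exists a finite connected graph `G` with
`cop(G) = k` and `acop(G) = 2k`; in particular the bound
`acop(G) ≤ 2 ⬝ cop(G)` is tight for every `k ≥ 2`. -/
theorem exists_graph_copNumber_eq_acop_half (k : ℕ) (hk : 2 ≤ k) :
    ∃ (W : Type) (_ : Fintype W) (G : SimpleGraph W),
      G.Connected ∧ copNumber G = k ∧ acop G = 2 * k := by
  obtain ⟨p, hkp, hp⟩ := Nat.exists_infinite_primes k
  have : Fact p.Prime := ⟨hp⟩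
  let s : Fin k → ZMod p := fun j => (j.val : ZMod p)
  have hs : Function.Injective s := by
    intro j j' e
    have h := (ZMod.natCast_eq_natCast_iff' _ _ _).mp e
    rw [Nat.mod_eq_of_lt (by omega), Nat.mod_eq_of_lt (by omega)] at h
    exact Fin.ext h
  have ht : 0 < 2 * k := by omega
  obtain ⟨c, hc⟩ := crPassive_upper hs hk ht
  refine ⟨CRBase (ZMod p) k × Fin (2 * k), inferInstance, crG s (2 * k),
    crConnected hs hk ht, ?_, ?_⟩
  · refine IsLeast.csInf_eq ⟨passive_win 6 c hc, fun n hn => ?_⟩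
    by_contra h
    exact crPassive_lower hs ht (not_le.mp h) hn
  · have hnb : ∀ v, ∃ w, (crG s (2 * k)).Adj v w :=
      fun v => ⟨(crNb s v.1 ⟨0, by omega⟩, v.2), crNb_adj s v.1 _⟩
    refine IsLeast.csInf_eq ⟨?_, fun n hn => ?_⟩
    · have E : Bool × Fin k ≃ Fin (2 * k) := Fintype.equivFinOfCardEq (by simp)
      choose w hw using hnb
      refine active_win (fun v => ⟨w v, hw v⟩) 6
        (fun j => if (E.symm j).1 then c (E.symm j).2 else w (c (E.symm j).2)) fun r => ?_
      refine active_sim E 6 c _ r (fun i => ⟨true, ?_, ?_⟩) (hc r)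
      · simp
      · simp [hw]
    · by_contra h
      exact crActive_lower hs (not_le.mp h) (not_le.mp h) hn
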